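/- Every input-total progCGS G that is simulation secure satisfies GNI: for all paths p, p' of G from the initial state s0 there exists a path p'' of G from s0 such that Lab(p(t)) ∩ H = Lab(p''(t)) ∩ H and Lab(p'(t)) ∩ (L ∪ O) = Lab(p''(t)) ∩ (L ∪ O) for all t. -/

import Mathlib

/-- The three agents of a progCGS: `N` resolves nondeterminism,
`H` chooses high-security inputs, `L` chooses low-security inputs. -/
inductive PAgent where
  | N | H | L
deriving DecidableEq

/-- A program concurrent game structure (progCGS). -/
structure ProgCGS (S M AP : Type) where
  s0 : S
  δ : S → (PAgent → M) → S
  Lab : S → Set AP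
  Hs : Set AP
  Ls : Set AP
  Os : Set AP
  disjHL : Disjoint Hs Ls
  disjHO : Disjoint Hs Os
  disjLO : Disjoint Ls Os
  cover : Hs ∪ Ls ∪ Os = Set.univ
  hm : M → Set AP
  lm : M → Set AP
  hm_sub : ∀ m, hm m ⊆ Hs
  lm_sub : ∀ m, lm m ⊆ Ls
  labH : ∀ s σ, Lab (δ s σ) ∩ Hs = hm (σ PAgent.H)
  labL : ∀ s σ, Lab (δ s σ) ∩ Ls = lm (σ PAgent.L)
  det : ∀ s σ σ', σ PAgent.N = σ' PAgent.N → hm (σ PAgent.H) = hm (σ' PAgent.H) →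
      lm (σ PAgent.L) = lm (σ' PAgent.L) → δ s σ = δ s σ'

/-- Input-total: `hm` attains every subset of `Hs` and `lm` every subset of `Ls`. -/
def ProgCGS.InputTotal {S M AP : Type} (G : ProgCGS S M AP) : Prop :=
  (∀ v, v ⊆ G.Hs → ∃ m, G.hm m = v) ∧ (∀ v, v ⊆ G.Ls → ∃ m, G.lm m = v)

/-- `p` is a path from `s` in the game structure with transition function `δ`. -/
def IsPath {S Agent M : Type} (δ : S → (Agent → M) → S) (s : S) (p : ℕ → S) : Prop :=
  p 0 = s ∧ ∀ i, ∃ σ : Agent → M, δ (p i) σ = p (i + 1)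

/-- `s ⇒^{iL}_{iH} s'`. -/
def ProgCGS.StepTo {S M AP : Type} (G : ProgCGS S M AP)
    (s : S) (iL iH : Set AP) (s' : S) : Prop :=
  G.Lab s' ∩ G.Ls = iL ∧ G.Lab s' ∩ G.Hs = iH ∧ ∃ σ : PAgent → M, G.δ s σ = s'

/-- `R` is a security simulation. -/
def ProgCGS.SecuritySim {S M AP : Type} (G : ProgCGS S M AP)
    (R : S → S → Prop) : Prop :=
  ∀ s t, R s t →
    (G.Lab s ∩ G.Os = G.Lab t ∩ G.Os) ∧
    ∀ iL iH iH' : Set AP, iL ⊆ G.Ls → iH ⊆ G.Hs → iH' ⊆ G.Hs →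
      ∀ s', G.StepTo s iL iH s' → ∃ t', G.StepTo t iL iH' t' ∧ R s' t'

/-- `G` is simulation secure. -/
def ProgCGS.SimulationSecure {S M AP : Type} (G : ProgCGS S M AP) : Prop :=
  ∃ R : S → S → Prop, G.SecuritySim R ∧ R G.s0 G.s0

/-- A relation `Q n` between consecutive values can be iterated along an invariant `P n`. -/
theorem exists_seq_of_invariant {α : Type*} {P : ℕ → α → Prop} {Q : ℕ → α → α → Prop} {a : α}
    (h0 : P 0 a) (hstep : ∀ n x, P n x → ∃ y, Q n x y ∧ P (n + 1) y) :
    ∃ q : ℕ → α, q 0 = a ∧ (∀ n, P n (q n)) ∧ ∀ n, Q n (q n) (q (n + 1)) := by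
  choose f hQ hP using hstep
  let g : ∀ n, {x // P n x} := fun n =>
    Nat.rec ⟨a, h0⟩ (fun n x => ⟨f n x.1 x.2, hP n x.1 x.2⟩) n
  exact ⟨fun n => (g n).1, rfl, fun n => (g n).2, fun n => hQ n (g n).1 (g n).2⟩

/-- Every input-total progCGS that is simulation secure satisfies GNI. -/
theorem simulation_secure_implies_GNI {S M AP : Type}
    [Fintype S] [Fintype M] [Nonempty M] [Fintype AP]
    (G : ProgCGS S M AP) (hTotal : G.InputTotal) (hSec : G.SimulationSecure) :
    ∀ p p' : ℕ → S, IsPath G.δ G.s0 p → IsPath G.δ G.s0 p' →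
      ∃ p'' : ℕ → S, IsPath G.δ G.s0 p'' ∧
        (∀ t, G.Lab (p t) ∩ G.Hs = G.Lab (p'' t) ∩ G.Hs) ∧
        (∀ t, G.Lab (p' t) ∩ (G.Ls ∪ G.Os) = G.Lab (p'' t) ∩ (G.Ls ∪ G.Os)) := by
  intro p p' hp hp'
  obtain ⟨R, hR, hR0⟩ := hSec
  obtain ⟨q, hq0, hqR, hqstep⟩ := exists_seq_of_invariant
    (P := fun n t => R (p' n) t)
    (Q := fun n t t' => G.StepTo t (G.Lab (p' (n + 1)) ∩ G.Ls) (G.Lab (p (n + 1)) ∩ G.Hs) t')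
    (a := G.s0) (by simpa only [hp'.1] using hR0)
    (fun n t ht => (hR _ _ ht).2 _ _ _ Set.inter_subset_right Set.inter_subset_right
      Set.inter_subset_right (p' (n + 1)) ⟨rfl, rfl, hp'.2 n⟩)
  refine ⟨q, ⟨hq0, fun n => (hqstep n).2.2⟩, fun t => ?_, fun t => ?_⟩
  · cases t with
    | zero => rw [hp.1, hq0]
    | succ n => exact (hqstep n).2.1.symm
  · rw [Set.inter_union_distrib_left, Set.inter_union_distrib_left, (hR _ _ (hqR t)).1]
    cases t with
    | zero => rw [hp'.1, hq0]
    | succ n => rw [(hqstep n).1]
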